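/- The shuffle algebra A⁺ is closed under the shuffle product: if P ∈ V_k equals p_P(z₁,…,z_k)·∏_{1≤i≠j≤k}(z_i−z_j) / ∏_{1≤i≠j≤k}((z_i−q₁z_j)(z_i−q₂z_j)) and Q ∈ V_l equals p_Q(z₁,…,z_l)·∏_{1≤i≠j≤l}(z_i−z_j) / ∏_{1≤i≠j≤l}((z_i−q₁z_j)(z_i−q₂z_j)), where p_P and p_Q are symmetric Laurent polynomials satisfying the wheel conditions, then P*Q equals p(z₁,…,z_{k+l})·∏_{1≤i≠j≤k+l}(z_i−z_j) / ∏_{1≤i≠j≤k+l}((z_i−q₁z_j)(z_i−q₂z_j)) for some symmetric Laurent polynomial p satisfying the wheel conditions. -/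

import Mathlib

open MvPolynomial

noncomputable section

set_option synthInstance.maxHeartbeats 1000000
set_option maxHeartbeats 2000000

/-- The field `F = ℚ(q₁,q₂)` of rational functions in two variables over `ℚ`. -/
abbrev F : Type := FractionRing (MvPolynomial (Fin 2) ℚ)

/-- The variable `q₁ ∈ F`. -/
def q1 : F := algebraMap (MvPolynomial (Fin 2) ℚ) F (X 0)

/-- The variable `q₂ ∈ F`. -/
def q2 : F := algebraMap (MvPolynomial (Fin 2) ℚ) F (X 1)

/-- The field of rational functions in `z₁,…,z_k` over `F`; `V_k` is the subspace of
symmetric elements (`RF 0 = V₀ = F`). -/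
abbrev RF (k : ℕ) : Type := FractionRing (MvPolynomial (Fin k) F)

/-- The variable `z_i ∈ RF k`. -/
def z {k : ℕ} (i : Fin k) : RF k := algebraMap (MvPolynomial (Fin k) F) (RF k) (X i)

/-- A constant `a ∈ F`, regarded inside `RF k`. -/
def cst {k : ℕ} (a : F) : RF k := algebraMap (MvPolynomial (Fin k) F) (RF k) (C a)

/-- The kernel `ω(x) = (x−1)(x−q)/((x−q₁)(x−q₂))`, where `q = q₁q₂`. -/
def omg {n : ℕ} (x : RF n) : RF n :=
  ((x - 1) * (x - cst (q1 * q2))) / ((x - cst q1) * (x - cst q2))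

/-- The field embedding `RF k → RF n` induced by an injection `f : Fin k → Fin n` of
variables: it sends `P(z₁,…,z_k)` to `P(z_{f(1)},…,z_{f(k)})`. -/
def emb {k n : ℕ} {f : Fin k → Fin n} (hf : Function.Injective f) : RF k →+* RF n :=
  IsFractionRing.lift (g := (algebraMap (MvPolynomial (Fin n) F) (RF n)).comp
      (rename f).toRingHom)
    ((IsFractionRing.injective (MvPolynomial (Fin n) F) (RF n)).comp
      (rename_injective f hf))

lemma castAdd_inj (k l : ℕ) : Function.Injective (Fin.castAdd l : Fin k → Fin (k + l)) :=
  fun a b h => by simpa [Fin.ext_iff] using h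

lemma natAdd_inj (k l : ℕ) : Function.Injective (Fin.natAdd k : Fin l → Fin (k + l)) :=
  fun a b h => by
    have := congrArg Fin.val h
    simp only [Fin.coe_natAdd] at this
    exact Fin.ext (by omega)

/-- A rational function `P ∈ RF k` is symmetric (i.e. belongs to `V_k`) if it is
invariant under every permutation of the variables. -/
def SymmFun {k : ℕ} (P : RF k) : Prop :=
  ∀ τ : Equiv.Perm (Fin k), emb τ.injective P = P

/-- The shuffle product: for `P ∈ V_k` and `Q ∈ V_l`,
`(P*Q)(z₁,…,z_{k+l}) = (1/(k!·l!)) Σ_{σ ∈ S_{k+l}} P(z_{σ(1)},…,z_{σ(k)})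
  Q(z_{σ(k+1)},…,z_{σ(k+l)}) ∏_{i=1}^{k} ∏_{j=k+1}^{k+l} ω(z_{σ(i)}/z_{σ(j)})`. -/
def shuffle {k l : ℕ} (P : RF k) (Q : RF l) : RF (k + l) :=
  (((k.factorial * l.factorial : ℕ) : RF (k + l)))⁻¹ *
    ∑ σ : Equiv.Perm (Fin (k + l)),
      emb (σ.injective.comp (castAdd_inj k l)) P *
        emb (σ.injective.comp (natAdd_inj k l)) Q *
        ∏ i : Fin k, ∏ j : Fin l,
          omg (z (σ (Fin.castAdd l i)) / z (σ (Fin.natAdd k j)))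

/-- Re-indexing isomorphism `RF k → RF n` along an equality `k = n`. -/
def embCast {k n : ℕ} (h : k = n) : RF k →+* RF n := emb (finCongr h).injective

/-- The substitution `z₁ ↦ z, z₂ ↦ c·z, z₃ ↦ q₁q₂·z, z_i ↦ w_i (i ≥ 4)` used in the
wheel conditions (variables indexed from `0` in Lean: `0 ↦ X 0`, `1 ↦ c·X 0`,
`2 ↦ q₁q₂·X 0`, `i ↦ X i` otherwise). -/
def wheelMap {k : ℕ} (c : F) (i : Fin k) : MvPolynomial (Fin k) F :=
  if (i : ℕ) = 1 then C c * X ⟨0, i.pos⟩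
  else if (i : ℕ) = 2 then C (q1 * q2) * X ⟨0, i.pos⟩
  else X i

/-- The wheel conditions for a (numerator of a) Laurent polynomial in `k` variables:
`p(z, q₁z, q₁q₂z, w₄,…,w_k) = 0 = p(z, q₂z, q₁q₂z, w₄,…,w_k)` identically; the
condition is vacuous for `k ≤ 2`. -/
def SatisfiesWheel {k : ℕ} (p : MvPolynomial (Fin k) F) : Prop :=
  3 ≤ k → (aeval (wheelMap q1) p = 0 ∧ aeval (wheelMap q2) p = 0)

/-- A polynomial is symmetric if it is invariant under all permutations of the
variables. -/
def SymmPoly {k : ℕ} (p : MvPolynomial (Fin k) F) : Prop :=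
  ∀ τ : Equiv.Perm (Fin k), rename (⇑τ) p = p

/-- The set of ordered pairs `(i,j)` with `i ≠ j`. -/
def offDiag (k : ℕ) : Finset (Fin k × Fin k) :=
  Finset.univ.filter (fun ij => ij.1 ≠ ij.2)

/-- The Vandermonde-type product `∏_{1≤i≠j≤k} (z_i − z_j)`. -/
def vand {k : ℕ} : RF k := ∏ ij ∈ offDiag k, (z ij.1 - z ij.2)

/-- The denominator `∏_{1≤i≠j≤k} (z_i − q₁z_j)(z_i − q₂z_j)`. -/
def denomProd {k : ℕ} : RF k :=
  ∏ ij ∈ offDiag k, ((z ij.1 - cst q1 * z ij.2) * (z ij.1 - cst q2 * z ij.2))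

/-- Membership in the shuffle algebra `𝒜⁺ ⊆ V_k`: `P` has the form
`p(z₁,…,z_k) · ∏_{i≠j}(z_i−z_j) / ∏_{i≠j}(z_i−q₁z_j)(z_i−q₂z_j)` where
`p = p₀/(z₁⋯z_k)^N` is a symmetric Laurent polynomial satisfying the wheel
conditions. -/
def InShuffleAlg {k : ℕ} (P : RF k) : Prop :=
  ∃ (p : MvPolynomial (Fin k) F) (N : ℕ), SymmPoly p ∧ SatisfiesWheel p ∧
    P = (algebraMap (MvPolynomial (Fin k) F) (RF k) p / (∏ i : Fin k, z i) ^ N) *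
      vand / denomProd

lemma X_sub_X_ne {n : ℕ} {i j : Fin n} (h : i ≠ j) :
    (X i - X j : MvPolynomial (Fin n) F) ≠ 0 := by
  intro h0
  exact h (X_injective (sub_eq_zero.mp h0))

lemma q1_ne_zero : q1 ≠ 0 := by
  unfold q1
  rw [Ne, map_eq_zero_iff _ (IsFractionRing.injective (MvPolynomial (Fin 2) ℚ) F)]
  exact X_ne_zero _

lemma q2_ne_zero : q2 ≠ 0 := by
  unfold q2
  rw [Ne, map_eq_zero_iff _ (IsFractionRing.injective (MvPolynomial (Fin 2) ℚ) F)]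
  exact X_ne_zero _

lemma q1_ne_one : q1 ≠ 1 := by
  intro h
  unfold q1 at h
  rw [← map_one (algebraMap (MvPolynomial (Fin 2) ℚ) F)] at h
  have := congrArg (eval (fun _ => (0 : ℚ)))
    (IsFractionRing.injective (MvPolynomial (Fin 2) ℚ) F h)
  simp at this

lemma q2_ne_one : q2 ≠ 1 := by
  intro h
  unfold q2 at h
  rw [← map_one (algebraMap (MvPolynomial (Fin 2) ℚ) F)] at h
  have := congrArg (eval (fun _ => (0 : ℚ)))
    (IsFractionRing.injective (MvPolynomial (Fin 2) ℚ) F h)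
  simp at this

lemma q12_ne_one : q1 * q2 ≠ 1 := by
  intro h
  unfold q1 q2 at h
  rw [← map_one (algebraMap (MvPolynomial (Fin 2) ℚ) F), ← map_mul] at h
  have := congrArg (eval (fun _ => (0 : ℚ)))
    (IsFractionRing.injective (MvPolynomial (Fin 2) ℚ) F h)
  simp at this

/-! Products over off-diagonal pairs. -/

lemma prod_offDiag {M : Type*} [CommMonoid M] {n : ℕ} (h : Fin n → Fin n → M) :
    ∏ ij ∈ offDiag n, h ij.1 ij.2 = ∏ i, ∏ j, if i ≠ j then h i j else 1 := by
  unfold offDiag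
  rw [Finset.prod_filter, ← Finset.univ_product_univ, Finset.prod_product]

lemma prod_offDiag_perm {M : Type*} [CommMonoid M] {n : ℕ} (h : Fin n → Fin n → M)
    (σ : Equiv.Perm (Fin n)) :
    ∏ ij ∈ offDiag n, h ij.1 ij.2 = ∏ ij ∈ offDiag n, h (σ ij.1) (σ ij.2) := by
  rw [prod_offDiag, prod_offDiag (fun i j => h (σ i) (σ j)), ← Equiv.prod_comp σ]
  refine Finset.prod_congr rfl fun i _ => ?_
  rw [← Equiv.prod_comp σ]
  simp

lemma prod_offDiag_add {M : Type*} [CommMonoid M] {k l : ℕ}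
    (h : Fin (k + l) → Fin (k + l) → M) :
    ∏ ij ∈ offDiag (k + l), h ij.1 ij.2 =
      (∏ ij ∈ offDiag k, h (Fin.castAdd l ij.1) (Fin.castAdd l ij.2)) *
      (∏ ij ∈ offDiag l, h (Fin.natAdd k ij.1) (Fin.natAdd k ij.2)) *
      ∏ i : Fin k, ∏ j : Fin l, (h (Fin.castAdd l i) (Fin.natAdd k j) *
        h (Fin.natAdd k j) (Fin.castAdd l i)) := by
  rw [prod_offDiag, prod_offDiag (fun i j => h (Fin.castAdd l i) (Fin.castAdd l j)),
    prod_offDiag (fun i j => h (Fin.natAdd k i) (Fin.natAdd k j))]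
  have h1 : ∀ (i : Fin k) (j : Fin l), Fin.castAdd l i ≠ Fin.natAdd k j := by
    intro i j hh
    have := congrArg Fin.val hh
    simp at this
    omega
  have h2 : ∀ (i j : Fin k), Fin.castAdd l i = Fin.castAdd l j ↔ i = j :=
    fun i j => (castAdd_inj k l).eq_iff
  have h3 : ∀ (i j : Fin l), Fin.natAdd k i = Fin.natAdd k j ↔ i = j :=
    fun i j => (natAdd_inj k l).eq_iff
  simp only [Fin.prod_univ_add, Finset.prod_mul_distrib, h1, (h1 _ _).symm, h2, h3, ne_eq,
    not_false_eq_true, if_true]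
  rw [Finset.prod_comm (s := (Finset.univ : Finset (Fin l))) (t := (Finset.univ : Finset (Fin k)))
    (f := fun i j => h (Fin.natAdd k i) (Fin.castAdd l j))]
  ac_rfl

/-! The Vandermonde polynomial. -/

def VV (n : ℕ) : MvPolynomial (Fin n) F :=
  (Matrix.vandermonde (fun i : Fin n => (X i : MvPolynomial (Fin n) F))).det

lemma VV_eq (n : ℕ) : VV n = ∏ i : Fin n, ∏ j ∈ Finset.Ioi i, (X j - X i) :=
  Matrix.det_vandermonde _

lemma VV_ne (n : ℕ) : VV n ≠ 0 :=
  Matrix.det_vandermonde_ne_zero_iff.mpr X_injective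

lemma rename_VV {n : ℕ} (σ : Equiv.Perm (Fin n)) :
    rename σ (VV n) = ((Equiv.Perm.sign σ : ℤ) : MvPolynomial (Fin n) F) * VV n := by
  unfold VV
  rw [← Matrix.det_permute, AlgHom.map_det]
  congr 1
  ext i j : 2
  simp [Matrix.vandermonde_apply]

lemma aeval_VV_ne {n : ℕ} (f : Fin n → MvPolynomial (Fin n) F) (hf : Function.Injective f) :
    aeval f (VV n) ≠ 0 := by
  have : aeval f (VV n) = (Matrix.vandermonde f).det := by
    unfold VV
    rw [AlgHom.map_det]
    congr 1
    ext i j : 2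
    simp [Matrix.vandermonde_apply]
  rw [this]
  exact Matrix.det_vandermonde_ne_zero_iff.mpr hf

def D1 (k l : ℕ) : MvPolynomial (Fin (k + l)) F :=
  ∏ i : Fin k, ∏ j : Fin l, (X (Fin.natAdd k j) - X (Fin.castAdd l i))

lemma D1_dvd (k l : ℕ) : D1 k l ∣ VV (k + l) := by
  rw [VV_eq]
  have : ∀ i : Fin (k + l), ∏ j ∈ Finset.Ioi i, (X j - X i : MvPolynomial (Fin (k + l)) F) =
      ∏ j, if i < j then X j - X i else 1 := by
    intro i
    rw [← Finset.prod_filter]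
    congr 1
    ext; simp
  simp only [this]
  have h1 : ∀ (i : Fin k) (j : Fin l), Fin.castAdd l i < Fin.natAdd k j := by
    intro i j
    rw [Fin.lt_def]
    simp
    omega
  simp only [Fin.prod_univ_add, Finset.prod_mul_distrib, h1, if_true]
  exact (dvd_mul_right (D1 k l) _).trans (dvd_mul_left _ _)

lemma irred_sub {n : ℕ} {i j : Fin n} (h : i ≠ j) :
    Irreducible (X i - X j : MvPolynomial (Fin n) F) := by
  have := irreducible_mul_X_add (1 : MvPolynomial (Fin n) F) (-X j) i one_ne_zero (by simp)
    (by simpa [vars_neg] using h) isRelPrime_one_left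
  rwa [one_mul, ← sub_eq_add_neg] at this

lemma X_sub_dvd {n : ℕ} {i j : Fin n} (h : i ≠ j) (T : MvPolynomial (Fin n) F)
    (hT : rename (Equiv.swap i j) T = - T) : (X i - X j) ∣ T := by
  let f : Fin n → MvPolynomial (Fin n) F := fun m => if m = i then X j else X m
  have h1 : ∀ p : MvPolynomial (Fin n) F, (X i - X j) ∣ p - aeval f p := by
    intro p
    induction p using MvPolynomial.induction_on with
    | C a => simp
    | add p q hp hq =>
      rw [map_add, add_sub_add_comm]
      exact dvd_add hp hq
    | mul_X p m hp =>
      have : p * X m - aeval f (p * X m) = (p - aeval f p) * X m + aeval f p * (X m - f m) := by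
        rw [map_mul, aeval_X]; ring
      rw [this]
      refine dvd_add (hp.mul_right _) (Dvd.dvd.mul_left ?_ _)
      by_cases hm : m = i
      · subst hm; simp [f]
      · simp [f, hm]
  have h2 : aeval f T = 0 := by
    have h3 : aeval f (rename (Equiv.swap i j) T) = aeval f T := by
      rw [aeval_rename]
      congr 2
      ext1 m
      by_cases hm : m = i
      · subst hm; simp [f]
      · by_cases hm' : m = j
        · subst hm'; simp [f]
        · simp [f, Equiv.swap_apply_of_ne_of_ne hm hm']
    rw [hT, map_neg] at h3
    have : (2 : MvPolynomial (Fin n) F) * aeval f T = 0 := by linear_combination -h3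
    exact (mul_eq_zero.mp this).resolve_left two_ne_zero
  have := h1 T
  rwa [h2, sub_zero] at this

lemma VV_dvd {n : ℕ} (T : MvPolynomial (Fin n) F)
    (hT : ∀ i j : Fin n, i ≠ j → rename (Equiv.swap i j) T = - T) : VV n ∣ T := by
  rw [VV_eq, Finset.prod_sigma']
  apply Finset.prod_dvd_of_isRelPrime
  · rintro ⟨a, b⟩ hab ⟨c, d⟩ hcd hne
    simp at hab hcd
    simp only [Function.onFun]
    rw [(irred_sub hab.ne').isRelPrime_iff_not_dvd]
    rintro hdvd
    -- evaluate at a point with `x a = x b` only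
    let x : Fin n → F := fun m => if m = b then ((a : ℕ) : F) else ((m : ℕ) : F)
    have h0 : eval x (X d - X c) = 0 := by
      obtain ⟨w, hw⟩ := hdvd
      rw [hw, map_mul]
      simp [x, hab.ne]
    simp only [map_sub, eval_X, x] at h0
    rw [sub_eq_zero] at h0
    apply hne
    have hab' : (a : ℕ) < b := hab
    have hcd' : (c : ℕ) < d := hcd
    split_ifs at h0 with e1 e2 e2
    · exact absurd (e2.trans e1.symm) hcd.ne
    · have := Nat.cast_injective h0
      subst e1
      obtain rfl : a = c := Fin.ext this
      rfl
    · have := Nat.cast_injective h0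
      subst e2
      omega
    · have := Nat.cast_injective h0
      omega
  · rintro ⟨a, b⟩ hab
    simp at hab
    exact X_sub_dvd hab.ne' T (hT b a hab.ne')

/-! Wheel condition machinery. -/

lemma wheel_vanish {k n : ℕ} (p : MvPolynomial (Fin k) F) (hs : SymmPoly p) (c : F)
    (hw : 3 ≤ k → aeval (wheelMap c) p = 0) (f : Fin k → MvPolynomial (Fin n) F)
    (a0 a1 a2 : Fin k) (h01 : a0 ≠ a1) (h02 : a0 ≠ a2) (h12 : a1 ≠ a2)
    (h1 : f a1 = C c * f a0) (h2 : f a2 = C (q1 * q2) * f a0) : aeval f p = 0 := by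
  have hk : 3 ≤ k := by
    have : ({a0, a1, a2} : Finset (Fin k)).card = 3 := by
      rw [Finset.card_eq_three]; exact ⟨a0, a1, a2, h01, h02, h12, rfl⟩
    calc 3 = _ := this.symm
      _ ≤ _ := Finset.card_le_univ _
      _ = k := by simp
  let u : Fin 3 → Fin k := fun i => Fin.castLE hk i
  let v : Fin 3 → Fin k := ![a0, a1, a2]
  have hu : Function.Injective u := Fin.castLE_injective hk
  have hv : Function.Injective v := by
    intro i j hij
    fin_cases i <;> fin_cases j <;> simp_all [v]
  obtain ⟨τ, hτ⟩ : ∃ τ : Equiv.Perm (Fin k), ∀ i, τ (u i) = v i := by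
    let e : Set.range u ≃ Set.range v :=
      (Equiv.ofInjective u hu).symm.trans (Equiv.ofInjective v hv)
    refine ⟨e.extendSubtype, fun i => ?_⟩
    rw [Equiv.extendSubtype_apply_of_mem e (u i) ⟨i, rfl⟩]
    have : (⟨u i, ⟨i, rfl⟩⟩ : Set.range u) = Equiv.ofInjective u hu i := rfl
    rw [this]
    simp [e]
  have t0 : τ ⟨0, by omega⟩ = a0 := hτ 0
  have t1 : τ ⟨1, by omega⟩ = a1 := hτ 1
  have t2 : τ ⟨2, by omega⟩ = a2 := hτ 2
  rw [← hs τ, aeval_rename]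
  have key : (aeval (f ∘ τ) : MvPolynomial (Fin k) F →ₐ[F] _) =
      (aeval (f ∘ τ)).comp (aeval (wheelMap c)) := by
    apply MvPolynomial.algHom_ext
    intro i
    simp only [AlgHom.comp_apply, aeval_X, wheelMap]
    split_ifs with e1 e2
    · have hi : i = ⟨1, by clear e1; omega⟩ := Fin.ext e1
      rw [hi]
      simp [t0, t1, h1, algebraMap_eq]
    · have hi : i = ⟨2, by clear e1 e2; omega⟩ := Fin.ext e2
      rw [hi]
      simp [t0, t2, h2, algebraMap_eq]
    · simp
  rw [key, AlgHom.comp_apply, hw hk, map_zero]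

lemma wheelMap_inj {n : ℕ} (c : F) (hc0 : c ≠ 0) (hc1 : c ≠ 1) (hcq : c ≠ q1 * q2) :
    Function.Injective (wheelMap c : Fin n → MvPolynomial (Fin n) F) := by
  have key : ∀ i j : Fin n, (i : ℕ) < j → wheelMap c i ≠ wheelMap c j := by
    intro i j hij h
    have hn : 0 < n := i.pos
    have ev := fun x : Fin n → F => congrArg (eval x) h
    have e1 := ev (fun m => if m = ⟨0, hn⟩ then 1 else 0)
    have e2 := ev (fun m => if m = j then 1 else 0)
    have hj : j ≠ ⟨0, hn⟩ := by
      rintro rfl; simp at hij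
    have hji : i ≠ j := by rintro rfl; simp at hij
    unfold wheelMap at e1 e2
    have hq := mul_ne_zero q1_ne_zero q2_ne_zero
    have hq1 := q12_ne_one
    split_ifs at e1 e2 <;> simp_all [Fin.ext_iff] <;>
      first | omega | (have : (i : ℕ) = 0 := by omega
                       simp_all)
  intro i j h
  rcases lt_trichotomy (i : ℕ) j with h' | h' | h'
  · exact absurd h (key i j h')
  · exact Fin.ext h'
  · exact absurd h.symm (key j i h')

/-! The numerator. -/

def gg {n : ℕ} (a b : Fin n) : MvPolynomial (Fin n) F :=
  (X a - C (q1 * q2) * X b) * (X b - C q1 * X a) * (X b - C q2 * X a)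

def N1 {k l : ℕ} (p : MvPolynomial (Fin k) F) (q : MvPolynomial (Fin l) F) :
    MvPolynomial (Fin (k + l)) F :=
  rename (Fin.castAdd l) p * rename (Fin.natAdd k) q *
    ∏ i : Fin k, ∏ j : Fin l, gg (Fin.castAdd l i) (Fin.natAdd k j)

lemma aeval_N1 {k l : ℕ} (p : MvPolynomial (Fin k) F) (q : MvPolynomial (Fin l) F)
    (hp : SymmPoly p) (hq : SymmPoly q) (c c' : F) (hc : c * c' = q1 * q2)
    (hcc : (c = q1 ∧ c' = q2) ∨ (c = q2 ∧ c' = q1))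
    (hwp : 3 ≤ k → aeval (wheelMap c) p = 0) (hwq : 3 ≤ l → aeval (wheelMap c) q = 0)
    (f : Fin (k + l) → MvPolynomial (Fin (k + l)) F)
    (a0 a1 a2 : Fin (k + l)) (h01 : a0 ≠ a1) (h02 : a0 ≠ a2) (h12 : a1 ≠ a2)
    (h1 : f a1 = C c * f a0) (h2 : f a2 = C (q1 * q2) * f a0) :
    aeval f (N1 p q) = 0 := by
  have h3 : f a2 = C c' * f a1 := by
    rw [h2, h1, ← hc, C_mul]; ring
  -- a vanishing cross factor
  have cross : ∀ (i : Fin k) (j : Fin l), aeval f (gg (Fin.castAdd l i) (Fin.natAdd k j)) = 0 →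
      aeval f (N1 p q) = 0 := by
    intro i j h
    unfold N1
    rw [map_mul, map_prod]
    apply mul_eq_zero_of_right
    apply Finset.prod_eq_zero (Finset.mem_univ i)
    rw [map_prod]
    exact Finset.prod_eq_zero (Finset.mem_univ j) h
  have g1 : ∀ a b : Fin (k + l), f b = C c * f a → aeval f (gg a b) = 0 := by
    intro a b h
    unfold gg
    simp only [map_mul, map_sub, aeval_X, aeval_C, algebraMap_eq, h]
    rcases hcc with ⟨rfl, rfl⟩ | ⟨rfl, rfl⟩ <;> ring
  have g2 : ∀ a b : Fin (k + l), f b = C c' * f a → aeval f (gg a b) = 0 := by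
    intro a b h
    unfold gg
    simp only [map_mul, map_sub, aeval_X, aeval_C, algebraMap_eq, h]
    rcases hcc with ⟨rfl, rfl⟩ | ⟨rfl, rfl⟩ <;> ring
  have g3 : ∀ a b : Fin (k + l), f a = C (q1 * q2) * f b → aeval f (gg a b) = 0 := by
    intro a b h
    unfold gg
    simp only [map_mul, map_sub, aeval_X, aeval_C, algebraMap_eq, h]
    ring
  induction a0 using Fin.addCases with
  | left i0 =>
    induction a1 using Fin.addCases with
    | left i1 =>
      induction a2 using Fin.addCases with
      | left i2 =>
        unfold N1
        rw [map_mul, map_mul, aeval_rename, wheel_vanish p hp c hwp (f ∘ Fin.castAdd l) i0 i1 i2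
          (by rintro rfl; exact h01 rfl) (by rintro rfl; exact h02 rfl)
          (by rintro rfl; exact h12 rfl) h1 h2]
        simp
      | right j2 => exact cross i1 j2 (g2 _ _ h3)
    | right j1 => exact cross i0 j1 (g1 _ _ h1)
  | right j0 =>
    induction a1 using Fin.addCases with
    | left i1 =>
      induction a2 using Fin.addCases with
      | left i2 => exact cross i2 j0 (g3 _ _ h2)
      | right j2 => exact cross i1 j2 (g2 _ _ h3)
    | right j1 =>
      induction a2 using Fin.addCases with
      | left i2 => exact cross i2 j0 (g3 _ _ h2)
      | right j2 =>
        unfold N1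
        rw [map_mul, map_mul, aeval_rename, aeval_rename,
          wheel_vanish q hq c hwq (f ∘ Fin.natAdd k) j0 j1 j2
          (by rintro rfl; exact h01 rfl) (by rintro rfl; exact h02 rfl)
          (by rintro rfl; exact h12 rfl) h1 h2]
        simp

/-- Antisymmetrization. -/
def Alt {n : ℕ} (M : MvPolynomial (Fin n) F) : MvPolynomial (Fin n) F :=
  ∑ σ : Equiv.Perm (Fin n), ((Equiv.Perm.sign σ : ℤ) : MvPolynomial (Fin n) F) * rename σ M

lemma rename_Alt {n : ℕ} (M : MvPolynomial (Fin n) F) (τ : Equiv.Perm (Fin n)) :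
    rename τ (Alt M) = ((Equiv.Perm.sign τ : ℤ) : MvPolynomial (Fin n) F) * Alt M := by
  unfold Alt
  rw [map_sum, Finset.mul_sum, ← Equiv.sum_comp (Equiv.mulLeft τ)
    (fun σ => ((Equiv.Perm.sign τ : ℤ) : MvPolynomial (Fin n) F) *
      (((Equiv.Perm.sign σ : ℤ) : MvPolynomial (Fin n) F) * rename σ M))]
  refine Finset.sum_congr rfl fun σ _ => ?_
  rw [map_mul, map_intCast, rename_rename, ← mul_assoc]
  congr 1
  simp only [Equiv.coe_mulLeft, Equiv.Perm.sign_mul, Units.val_mul, Int.cast_mul]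
  rcases Int.units_eq_one_or (Equiv.Perm.sign τ) with h | h <;> simp [h] <;> ring

lemma exists_s {k l : ℕ} (p : MvPolynomial (Fin k) F) (q : MvPolynomial (Fin l) F)
    (hp : SymmPoly p) (hq : SymmPoly q) (hwp : SatisfiesWheel p) (hwq : SatisfiesWheel q)
    (E : MvPolynomial (Fin (k + l)) F) :
    ∃ s : MvPolynomial (Fin (k + l)) F, SymmPoly s ∧ SatisfiesWheel s ∧
      Alt (N1 p q * E) = VV (k + l) * s := by
  obtain ⟨s, hs⟩ : VV (k + l) ∣ Alt (N1 p q * E) := by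
    apply VV_dvd
    intro i j hij
    rw [rename_Alt, Equiv.Perm.sign_swap hij]
    simp
    ring
  refine ⟨s, ?_, ?_, hs⟩
  · intro τ
    have h := rename_Alt (N1 p q * E) τ
    rw [hs, map_mul, rename_VV, mul_assoc] at h
    have hsg : ((Equiv.Perm.sign τ : ℤ) : MvPolynomial (Fin (k + l)) F) ≠ 0 := by
      rcases Int.units_eq_one_or (Equiv.Perm.sign τ) with h | h <;> simp [h]
    exact mul_left_cancel₀ (VV_ne _) (mul_left_cancel₀ hsg h)
  · intro hn
    have main : ∀ c c' : F, c * c' = q1 * q2 → ((c = q1 ∧ c' = q2) ∨ (c = q2 ∧ c' = q1)) →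
        c ≠ 0 → c ≠ 1 → c ≠ q1 * q2 → (3 ≤ k → aeval (wheelMap c) p = 0) →
        (3 ≤ l → aeval (wheelMap c) q = 0) → aeval (wheelMap c) s = 0 := by
      intro c c' hc hcc hc0 hc1 hcq hwp hwq
      have h := congrArg (aeval (wheelMap c)) hs
      rw [map_mul] at h
      have h0 : aeval (wheelMap c) (Alt (N1 p q * E)) = 0 := by
        unfold Alt
        rw [map_sum]
        refine Finset.sum_eq_zero fun σ _ => ?_
        rw [map_mul, aeval_rename, map_mul (aeval (wheelMap c ∘ σ)),
          aeval_N1 p q hp hq c c' hc hcc hwp hwq (wheelMap c ∘ σ)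
            (σ.symm ⟨0, by omega⟩) (σ.symm ⟨1, by omega⟩) (σ.symm ⟨2, by omega⟩)
            (by simp) (by simp) (by simp) (by simp [wheelMap]) (by simp [wheelMap])]
        simp
      rw [h0] at h
      exact (mul_eq_zero.mp h.symm).resolve_left (aeval_VV_ne _ (wheelMap_inj c hc0 hc1 hcq))
    constructor
    · refine main q1 q2 rfl (Or.inl ⟨rfl, rfl⟩) q1_ne_zero q1_ne_one ?_
        (fun h => (hwp h).1) (fun h => (hwq h).1)
      intro h
      exact q2_ne_one (mul_left_cancel₀ q1_ne_zero (by rw [← h, mul_one]))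
    · refine main q2 q1 (mul_comm _ _) (Or.inr ⟨rfl, rfl⟩) q2_ne_zero q2_ne_one ?_
        (fun h => (hwp h).2) (fun h => (hwq h).2)
      intro h
      exact q1_ne_one (mul_right_cancel₀ q2_ne_zero (by rw [← h, one_mul]))

/-! Passing to the fraction field. -/

lemma emb_alg {k n : ℕ} {f : Fin k → Fin n} (hf : Function.Injective f)
    (p : MvPolynomial (Fin k) F) :
    emb hf (algebraMap _ (RF k) p) = algebraMap _ (RF n) (rename f p) := by
  unfold emb
  rw [IsFractionRing.lift_algebraMap]
  rfl

lemma emb_z {k n : ℕ} {f : Fin k → Fin n} (hf : Function.Injective f) (i : Fin k) :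
    emb hf (z i) = z (f i) := by
  unfold z
  rw [emb_alg, rename_X]

lemma emb_cst {k n : ℕ} {f : Fin k → Fin n} (hf : Function.Injective f) (a : F) :
    emb hf (cst a) = cst a := by
  unfold cst
  rw [emb_alg, rename_C]

lemma z_ne {n : ℕ} (i : Fin n) : (z i : RF n) ≠ 0 := by
  unfold z
  rw [Ne, map_eq_zero_iff _ (IsFractionRing.injective (MvPolynomial (Fin n) F) (RF n))]
  exact X_ne_zero _

lemma z_sub_ne {n : ℕ} {i j : Fin n} (h : i ≠ j) (c : F) :
    (z i - cst c * z j : RF n) ≠ 0 := by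
  unfold z cst
  rw [← map_mul, ← map_sub, Ne,
    map_eq_zero_iff _ (IsFractionRing.injective (MvPolynomial (Fin n) F) (RF n))]
  intro h0
  have := congrArg (eval (fun m => if m = i then (1 : F) else 0)) h0
  simp [h.symm] at this

lemma z_sub_ne' {n : ℕ} {i j : Fin n} (h : i ≠ j) : (z i - z j : RF n) ≠ 0 := by
  have := z_sub_ne h 1
  simpa [cst] using this

lemma omg_eq {n : ℕ} {a b : Fin n} (h : a ≠ b) :
    (omg (z a / z b) : RF n) = (algebraMap _ (RF n) (gg a b) / (z b - z a)) *
      ((z a - z b) * (z b - z a)) /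
      (((z a - cst q1 * z b) * (z a - cst q2 * z b)) *
        ((z b - cst q1 * z a) * (z b - cst q2 * z a))) := by
  have e : algebraMap _ (RF n) (gg a b) = (z a - cst (q1 * q2) * z b) * (z b - cst q1 * z a) *
      (z b - cst q2 * z a) := by
    simp only [gg, z, cst, map_mul, map_sub]
  rw [e]
  have hz := z_ne b
  have h1 := z_sub_ne h q1
  have h2 := z_sub_ne h q2
  have h3 := z_sub_ne h.symm q1
  have h4 := z_sub_ne h.symm q2
  have h5 := z_sub_ne' h.symm
  have w : ∀ x : RF n, z a / z b - x = (z a - x * z b) / z b := by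
    intro x; field_simp
  unfold omg
  rw [w, w, w, w, one_mul]
  generalize (z a - cst q1 * z b : RF n) = A at *
  generalize (z a - cst q2 * z b : RF n) = B at *
  generalize (z b - cst q1 * z a : RF n) = A' at *
  generalize (z b - cst q2 * z a : RF n) = B' at *
  generalize (z a - cst (q1 * q2) * z b : RF n) = G at *
  generalize (z b - z a : RF n) = H at *
  field_simp

lemma denom_ne (n : ℕ) : (denomProd : RF n) ≠ 0 := by
  unfold denomProd
  rw [Finset.prod_ne_zero_iff]
  rintro ⟨i, j⟩ h
  simp only [offDiag, Finset.mem_filter] at h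
  exact mul_ne_zero (z_sub_ne h.2 _) (z_sub_ne h.2 _)

/-- The summand of the shuffle product. -/
lemma term_eq {k l : ℕ} (p : MvPolynomial (Fin k) F) (q : MvPolynomial (Fin l) F) (N : ℕ)
    (σ : Equiv.Perm (Fin (k + l))) :
    emb (σ.injective.comp (castAdd_inj k l))
        ((algebraMap _ (RF k) p / (∏ i : Fin k, z i) ^ N) * vand / denomProd) *
      emb (σ.injective.comp (natAdd_inj k l))
        ((algebraMap _ (RF l) q / (∏ i : Fin l, z i) ^ N) * vand / denomProd) *
      ∏ i : Fin k, ∏ j : Fin l, omg (z (σ (Fin.castAdd l i)) / z (σ (Fin.natAdd k j))) =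
    (algebraMap _ (RF (k + l)) (rename σ (N1 p q)) / algebraMap _ (RF (k + l)) (rename σ (D1 k l)))
      / (∏ i : Fin (k + l), z i) ^ N * vand / denomProd := by
  have hne : ∀ (i : Fin k) (j : Fin l), σ (Fin.castAdd l i) ≠ σ (Fin.natAdd k j) := by
    intro i j hh
    have := congrArg Fin.val (σ.injective hh)
    simp at this
    omega
  have hz : (∏ i : Fin (k + l), z i : RF (k + l)) =
      (∏ i : Fin k, z (σ (Fin.castAdd l i))) * ∏ i : Fin l, z (σ (Fin.natAdd k i)) := by
    rw [← Equiv.prod_comp σ, Fin.prod_univ_add]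
  have hv : (vand : RF (k + l)) = _ :=
    (prod_offDiag_perm (fun a b : Fin (k + l) => (z a - z b : RF (k + l))) σ).trans
      (prod_offDiag_add (fun a b : Fin (k + l) => (z (σ a) - z (σ b) : RF (k + l))))
  have hd : (denomProd : RF (k + l)) = _ :=
    (prod_offDiag_perm (fun a b : Fin (k + l) =>
      ((z a - cst q1 * z b) * (z a - cst q2 * z b) : RF (k + l))) σ).trans
      (prod_offDiag_add (fun a b : Fin (k + l) =>
        ((z (σ a) - cst q1 * z (σ b)) * (z (σ a) - cst q2 * z (σ b)) : RF (k + l))))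
  have hom : (∏ i : Fin k, ∏ j : Fin l,
      omg (z (σ (Fin.castAdd l i)) / z (σ (Fin.natAdd k j))) : RF (k + l)) = _ :=
    Finset.prod_congr rfl fun i _ => Finset.prod_congr rfl fun j _ => omg_eq (hne i j)
  have hN : algebraMap _ (RF (k + l)) (rename σ (N1 p q)) =
      algebraMap _ (RF (k + l)) (rename (σ ∘ Fin.castAdd l) p) *
      algebraMap _ (RF (k + l)) (rename (σ ∘ Fin.natAdd k) q) *
      ∏ i : Fin k, ∏ j : Fin l,
        algebraMap _ (RF (k + l)) (gg (σ (Fin.castAdd l i)) (σ (Fin.natAdd k j))) := by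
    simp only [N1, map_mul, map_prod, rename_rename, gg, map_sub, rename_X, rename_C]
  have hD : algebraMap _ (RF (k + l)) (rename σ (D1 k l)) =
      ∏ i : Fin k, ∏ j : Fin l, (z (σ (Fin.natAdd k j)) - z (σ (Fin.castAdd l i))) := by
    simp only [D1, map_prod, map_sub, rename_X, z]
  rw [hz, hv, hd, hom, hN, hD]
  simp only [vand, denomProd, map_mul, map_div₀, map_pow, map_prod, map_sub, emb_alg, emb_z,
    emb_cst, Function.comp, Finset.prod_div_distrib, Finset.prod_mul_distrib, mul_pow]
  simp only [div_eq_mul_inv, mul_inv]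
  ring

/-- Enlarging the power of the monomial denominator. -/
lemma enlarge {k : ℕ} (p : MvPolynomial (Fin k) F) (N M : ℕ) (hs : SymmPoly p)
    (hw : SatisfiesWheel p) : ∃ p' : MvPolynomial (Fin k) F, SymmPoly p' ∧ SatisfiesWheel p' ∧
      algebraMap _ (RF k) p / (∏ i : Fin k, z i) ^ N =
        algebraMap _ (RF k) p' / (∏ i : Fin k, z i) ^ (N + M) := by
  refine ⟨p * (∏ i, X i) ^ M, ?_, ?_, ?_⟩
  · intro τ
    rw [map_mul, hs τ, map_pow, map_prod]
    simp only [rename_X]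
    rw [Equiv.prod_comp τ (fun i => (X i : MvPolynomial (Fin k) F))]
  · intro hk
    rw [map_mul, map_mul, (hw hk).1, (hw hk).2, zero_mul, zero_mul]
    exact ⟨rfl, rfl⟩
  · have h : (∏ i : Fin k, z i : RF k) ≠ 0 := Finset.prod_ne_zero_iff.mpr fun i _ => z_ne i
    have e : algebraMap _ (RF k) (p * (∏ i, X i) ^ M) =
        algebraMap _ (RF k) p * (∏ i : Fin k, z i) ^ M := by
      simp only [map_mul, map_pow, map_prod, z]
    rw [e, pow_add]
    field_simp

/-- The shuffle algebra `𝒜⁺` is closed under the shuffle product: if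
`P ∈ V_k` and `Q ∈ V_l` both have the form (symmetric Laurent polynomial satisfying
the wheel conditions) · ∏(z_i−z_j) / ∏(z_i−q₁z_j)(z_i−q₂z_j), then so does `P*Q`. -/
theorem shuffle_algebra_closed {k l : ℕ} (P : RF k) (Q : RF l)
    (hP : InShuffleAlg P) (hQ : InShuffleAlg Q) :
    InShuffleAlg (shuffle P Q) := by
  obtain ⟨p0, N0, hps0, hpw0, rfl⟩ := hP
  obtain ⟨q0, M0, hqs0, hqw0, rfl⟩ := hQ
  obtain ⟨p, hps, hpw, hpe⟩ := enlarge p0 N0 M0 hps0 hpw0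
  obtain ⟨q, hqs, hqw, hqe⟩ := enlarge q0 M0 N0 hqs0 hqw0
  rw [add_comm M0 N0] at hqe
  rw [hpe, hqe]
  obtain ⟨E, hE⟩ := D1_dvd k l
  obtain ⟨s, hss, hsw, hs⟩ := exists_s p q hps hqs hpw hqw E
  refine ⟨C (((k.factorial * l.factorial : ℕ) : F)⁻¹) * s, N0 + M0, ?_, ?_, ?_⟩
  · intro τ
    rw [map_mul, hss τ, rename_C]
  · intro hk
    rw [map_mul, map_mul, (hsw hk).1, (hsw hk).2, mul_zero, mul_zero]
    exact ⟨rfl, rfl⟩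
  · unfold shuffle
    rw [Finset.sum_congr rfl fun σ _ => term_eq p q (N0 + M0) σ]
    have hinj := IsFractionRing.injective (MvPolynomial (Fin (k + l)) F) (RF (k + l))
    have hV : algebraMap _ (RF (k + l)) (VV (k + l)) ≠ 0 := by
      rw [Ne, map_eq_zero_iff _ hinj]
      exact VV_ne _
    have hsum : ∑ σ : Equiv.Perm (Fin (k + l)),
        algebraMap _ (RF (k + l)) (rename σ (N1 p q)) /
          algebraMap _ (RF (k + l)) (rename σ (D1 k l)) = algebraMap _ (RF (k + l)) s := by
      have h1 : ∀ σ : Equiv.Perm (Fin (k + l)), algebraMap _ (RF (k + l)) (rename σ (N1 p q)) /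
          algebraMap _ (RF (k + l)) (rename σ (D1 k l)) = algebraMap _ (RF (k + l))
            (((Equiv.Perm.sign σ : ℤ) : MvPolynomial (Fin (k + l)) F) * rename σ (N1 p q * E)) /
            algebraMap _ (RF (k + l)) (VV (k + l)) := by
        intro σ
        have hV' := rename_VV σ
        have hD : algebraMap _ (RF (k + l)) (rename σ (D1 k l)) ≠ 0 := by
          rw [Ne, map_eq_zero_iff _ hinj, map_eq_zero_iff _ (rename_injective _ σ.injective)]
          intro h0
          rw [h0, zero_mul] at hE
          exact VV_ne _ hE
        rw [div_eq_div_iff hD hV, ← map_mul, ← map_mul]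
        congr 1
        have hsg : ((Equiv.Perm.sign σ : ℤ) : MvPolynomial (Fin (k + l)) F) *
            ((Equiv.Perm.sign σ : ℤ) : MvPolynomial (Fin (k + l)) F) = 1 := by
          rcases Int.units_eq_one_or (Equiv.Perm.sign σ) with h | h <;> simp [h] <;> ring
        have hV2 : VV (k + l) = ((Equiv.Perm.sign σ : ℤ) : MvPolynomial (Fin (k + l)) F) *
            (rename σ (D1 k l) * rename σ E) := by
          rw [← map_mul, ← hE, hV', ← mul_assoc, hsg, one_mul]
        rw [hV2, map_mul]
        ring
      rw [Finset.sum_congr rfl fun σ _ => h1 σ, ← Finset.sum_div, ← map_sum]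
      change algebraMap _ (RF (k + l)) (Alt (N1 p q * E)) / _ = _
      rw [hs, map_mul, mul_div_cancel_left₀ _ hV]
    rw [← Finset.sum_div, ← Finset.sum_mul, ← Finset.sum_div, hsum]
    have hc : algebraMap _ (RF (k + l)) (C (((k.factorial * l.factorial : ℕ) : F)⁻¹) * s) =
        (((k.factorial * l.factorial : ℕ) : RF (k + l)))⁻¹ * algebraMap _ (RF (k + l)) s := by
      rw [map_mul]
      congr 1
      change ((algebraMap (MvPolynomial (Fin (k + l)) F) (RF (k + l))).comp C) _ = _
      rw [map_inv₀, map_natCast]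
    rw [hc]
    simp only [div_eq_mul_inv]
    ring
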